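/- Let (S, wt) be a full passport. For any subset S' ⊆ S with Σ_{s∈S'} wt(s) = 0, define NP_+(S') := Σ_{𝔮 ∈ 𝔓(S')} (−1)^{|𝔮|−1} X(𝔮). Then for every real number x: Σ_{𝔭 = {S_1,…,S_n} ∈ 𝔓(S)} x^{(n)} · ∏_{i=1}^{n} NP_+(S_i) = Σ_{𝔭 ∈ 𝔓(S)} x^{|𝔭|} · X(𝔭), where x^{(n)} := x(x+1)⋯(x+n−1) is the rising factorial. -/

import Mathlib

open Finset

/-- Cumulative sums of a permutation (linear ordering) of a finite subset `B`
with respect to the weight `wt`: `cumSumOn wt B P i = H_i`. -/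
noncomputable def cumSumOn {α : Type*} (wt : α → ℝ) (B : Finset α)
    (P : Fin B.card ≃ {x // x ∈ B}) (i : ℕ) : ℝ :=
  ∑ j ∈ Finset.univ.filter (fun j : Fin B.card => (j : ℕ) < i), wt (P j : α)

/-- A positive permutation of `B`: all proper cumulative sums are positive. -/
def PosPermOn {α : Type*} (wt : α → ℝ) (B : Finset α)
    (P : Fin B.card ≃ {x // x ∈ B}) : Prop :=
  ∀ i, 1 ≤ i → i ≤ B.card - 1 → 0 < cumSumOn wt B P i

/-- A tree permutation of `B`: (1) `H_i ≠ 0` for `1 ≤ i ≤ |B|-1`;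
(2) whenever `H_{k-1} = H_l > 0` (`1 ≤ k < l ≤ |B|`), `min{H_k,…,H_{l-1}} < H_l`;
(3) whenever `H_{k-1} = H_l < 0` (`1 ≤ k < l ≤ |B|`), `max{H_k,…,H_{l-1}} > H_l`. -/
def TreePermOn {α : Type*} (wt : α → ℝ) (B : Finset α)
    (P : Fin B.card ≃ {x // x ∈ B}) : Prop :=
  (∀ i, 1 ≤ i → i ≤ B.card - 1 → cumSumOn wt B P i ≠ 0) ∧
  (∀ k l, 1 ≤ k → k < l → l ≤ B.card →
    cumSumOn wt B P (k - 1) = cumSumOn wt B P l → 0 < cumSumOn wt B P l →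
    ∃ t, k ≤ t ∧ t < l ∧ cumSumOn wt B P t < cumSumOn wt B P l) ∧
  (∀ k l, 1 ≤ k → k < l → l ≤ B.card →
    cumSumOn wt B P (k - 1) = cumSumOn wt B P l → cumSumOn wt B P l < 0 →
    ∃ t, k ≤ t ∧ t < l ∧ cumSumOn wt B P l < cumSumOn wt B P t)

/-- `|P_+(B, wt)|`: the number of positive permutations of `B`. -/
noncomputable def numPos {α : Type*} (wt : α → ℝ) (B : Finset α) : ℕ :=
  Nat.card {P : Fin B.card ≃ {x // x ∈ B} // PosPermOn wt B P}

/-- `|PT_+(B, wt)|`: the number of positive tree permutations of `B`. -/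
noncomputable def numPosTree {α : Type*} (wt : α → ℝ) (B : Finset α) : ℕ :=
  Nat.card {P : Fin B.card ≃ {x // x ∈ B} // PosPermOn wt B P ∧ TreePermOn wt B P}

/-- `𝔭` is a partition of `S'` into nonempty zero-sum blocks. -/
def IsPart {α : Type*} (wt : α → ℝ) (S' : Finset α) (𝔭 : Finset (Finset α)) : Prop :=
  (∀ B ∈ 𝔭, B.Nonempty) ∧ (∀ B ∈ 𝔭, B ⊆ S') ∧
  (∀ a ∈ S', ∃! B, B ∈ 𝔭 ∧ a ∈ B) ∧ (∀ B ∈ 𝔭, ∑ s ∈ B, wt s = 0)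

/-- `X(𝔭) = ∏_{B ∈ 𝔭} (|B| - 1)!`. -/
def Xval {α : Type*} (𝔭 : Finset (Finset α)) : ℕ :=
  ∏ B ∈ 𝔭, Nat.factorial (B.card - 1)

open Classical in
/-- `NP_+(B) = Σ_{𝔮 ∈ 𝔓(B)} (−1)^{|𝔮|−1} X(𝔮)`. -/
noncomputable def NPplus {α : Type*} [Fintype α] (wt : α → ℝ) (B : Finset α) : ℝ :=
  ∑ 𝔮 ∈ Finset.univ.filter (IsPart wt B), (-1 : ℝ) ^ (𝔮.card - 1) * (Xval 𝔮 : ℝ)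

namespace IsPart

variable {α : Type*} {wt : α → ℝ}

theorem eq_of_mem {S : Finset α} {p : Finset (Finset α)} (h : IsPart wt S p) {a : α}
    {B C : Finset α} (hB : B ∈ p) (hC : C ∈ p) (haB : a ∈ B) (haC : a ∈ C) : B = C :=
  (h.2.2.1 a (h.2.1 B hB haB)).unique ⟨hB, haB⟩ ⟨hC, haC⟩

open Classical in
/-- A set with a zero-sum partition has zero sum. -/
theorem sum_eq_zero {S : Finset α} {p : Finset (Finset α)} (h : IsPart wt S p) :
    ∑ s ∈ S, wt s = 0 := by
  have hS : S = p.biUnion id := by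
    ext a
    simp only [mem_biUnion, id]
    exact ⟨fun ha => (h.2.2.1 a ha).exists, fun ⟨B, hB, haB⟩ => h.2.1 B hB haB⟩
  rw [hS, sum_biUnion]
  · exact Finset.sum_eq_zero h.2.2.2
  · intro B hB C hC hne
    exact disjoint_left.2 fun a haB haC => hne (h.eq_of_mem hB hC haB haC)

theorem empty_iff {p : Finset (Finset α)} : IsPart wt ∅ p ↔ p = ∅ := by
  constructor
  · intro h
    refine eq_empty_of_forall_notMem fun B hB => ?_
    obtain ⟨a, ha⟩ := h.1 B hB
    simpa using h.2.1 B hB ha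
  · rintro rfl
    simp [IsPart]

open Classical in
/-- Adding the block `insert a U` to a partition of `T \ U`. -/
theorem insert_block {T U : Finset α} {a : α} (ha : a ∉ T) (hU : U ⊆ T)
    (h0 : ∑ s ∈ insert a U, wt s = 0) {p : Finset (Finset α)} (h : IsPart wt (T \ U) p) :
    IsPart wt (insert a T) (insert (insert a U) p) := by
  obtain ⟨h1, h2, h3, h4⟩ := h
  refine ⟨?_, ?_, ?_, ?_⟩
  · exact forall_mem_insert _ _ _ |>.2 ⟨insert_nonempty _ _, h1⟩
  · exact forall_mem_insert _ _ _ |>.2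
      ⟨insert_subset_insert _ hU, fun B hB => ((h2 B hB).trans sdiff_subset).trans (subset_insert _ _)⟩
  · intro b hb
    by_cases hbU : b ∈ insert a U
    · refine ⟨insert a U, ⟨mem_insert_self _ _, hbU⟩, ?_⟩
      rintro C ⟨hC, hbC⟩
      rcases mem_insert.1 hC with rfl | hC
      · rfl
      · have := mem_sdiff.1 (h2 C hC hbC)
        rcases mem_insert.1 hbU with rfl | hbU
        · exact absurd this.1 ha
        · exact absurd hbU this.2
    · have hbT : b ∈ T \ U := by
        simp only [mem_insert, not_or, mem_sdiff] at hb hbU ⊢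
        exact ⟨hb.resolve_left hbU.1, hbU.2⟩
      obtain ⟨C, ⟨hC, hbC⟩, huniq⟩ := h3 b hbT
      refine ⟨C, ⟨mem_insert_of_mem hC, hbC⟩, ?_⟩
      rintro D ⟨hD, hbD⟩
      rcases mem_insert.1 hD with rfl | hD
      · exact absurd hbD hbU
      · exact huniq D ⟨hD, hbD⟩
  · exact forall_mem_insert _ _ _ |>.2 ⟨h0, h4⟩

open Classical in
/-- Removing a block from a partition. -/
theorem erase_block {S B : Finset α} {p : Finset (Finset α)} (h : IsPart wt S p) (hB : B ∈ p) :
    IsPart wt (S \ B) (p.erase B) := by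
  refine ⟨fun C hC => h.1 C (mem_of_mem_erase hC), ?_, ?_,
    fun C hC => h.2.2.2 C (mem_of_mem_erase hC)⟩
  · intro C hC b hbC
    obtain ⟨hne, hC⟩ := mem_erase.1 hC
    exact mem_sdiff.2 ⟨h.2.1 C hC hbC, fun hbB => hne (h.eq_of_mem hC hB hbC hbB)⟩
  · intro b hb
    obtain ⟨hbS, hbB⟩ := mem_sdiff.1 hb
    obtain ⟨C, ⟨hC, hbC⟩, huniq⟩ := h.2.2.1 b hbS
    refine ⟨C, ⟨mem_erase.2 ⟨?_, hC⟩, hbC⟩, fun D hD => huniq D ⟨mem_of_mem_erase hD.1, hD.2⟩⟩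
    rintro rfl
    exact hbB hbC

end IsPart

open Classical in
/-- The sum over all zero-sum partitions `p` of `S` of `g |p| * ∏ B ∈ p, f B`. -/
noncomputable def partSum {α : Type*} [Fintype α] (wt : α → ℝ) (g : ℕ → ℝ)
    (f : Finset α → ℝ) (S : Finset α) : ℝ :=
  ∑ p ∈ univ.filter (IsPart wt S), g p.card * ∏ B ∈ p, f B

section PartSum

variable {α : Type*} [Fintype α] (wt : α → ℝ)

theorem partSum_empty (g : ℕ → ℝ) (f : Finset α → ℝ) : partSum wt g f ∅ = g 0 := by
  classical
  have hP : univ.filter (IsPart wt (∅ : Finset α)) = {∅} := by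
    ext p
    simp [IsPart.empty_iff]
  rw [partSum, hP]
  simp

theorem partSum_eq_zero (g : ℕ → ℝ) (f : Finset α → ℝ) {S : Finset α}
    (hS : ∑ s ∈ S, wt s ≠ 0) : partSum wt g f S = 0 := by
  classical
  rw [partSum, filter_false_of_mem fun p _ hp => hS hp.sum_eq_zero, sum_empty]

theorem partSum_const_mul (c : ℝ) (g : ℕ → ℝ) (f : Finset α → ℝ) (S : Finset α) :
    partSum wt (fun n => c * g n) f S = c * partSum wt g f S := by
  simp only [partSum, mul_sum, mul_assoc]

open Classical in
/-- Decomposition of the partition sum according to the block that contains `a`. -/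
theorem partSum_insert (g : ℕ → ℝ) (f : Finset α → ℝ) {T : Finset α} {a : α} (ha : a ∉ T) :
    partSum wt g f (insert a T) = ∑ U ∈ T.powerset,
      (if ∑ s ∈ insert a U, wt s = 0 then f (insert a U) else 0) *
        partSum wt (fun n => g (n + 1)) f (T \ U) := by
  simp only [ite_mul, zero_mul]
  rw [← sum_filter]
  simp only [partSum, mul_sum]
  rw [sum_sigma']
  symm
  have hnot : ∀ {U : Finset α} {p : Finset (Finset α)}, IsPart wt (T \ U) p →
      ∀ B ∈ p, a ∉ B := fun h B hB haB => ha (mem_sdiff.1 (h.2.1 B hB haB)).1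
  refine sum_bij (fun x _ => insert (insert a x.1) x.2) ?_ ?_ ?_ ?_
  · rintro ⟨U, p⟩ hx
    simp only [mem_sigma, mem_filter, mem_powerset, mem_univ, true_and] at hx ⊢
    exact hx.2.insert_block ha hx.1.1 hx.1.2
  · rintro ⟨U, p⟩ hx ⟨V, q⟩ hy hxy
    simp only [mem_sigma, mem_filter, mem_powerset, mem_univ, true_and] at hx hy hxy
    have hUp : insert a U ∉ p := fun h => hnot hx.2 _ h (mem_insert_self _ _)
    have hVq : insert a V ∉ q := fun h => hnot hy.2 _ h (mem_insert_self _ _)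
    have hblock : insert a U = insert a V :=
      (hx.2.insert_block ha hx.1.1 hx.1.2).eq_of_mem (mem_insert_self _ _)
        (hxy ▸ mem_insert_self _ _) (mem_insert_self a U) (mem_insert_self a V)
    have hUV : U = V := by
      rw [← erase_insert (fun h => ha (hx.1.1 h)), hblock,
        erase_insert (fun h => ha (hy.1.1 h))]
    subst hUV
    have hpq : p = q := by rw [← erase_insert hUp, hxy, erase_insert hVq]
    rw [hpq]
  · intro p hp
    simp only [mem_filter, mem_univ, true_and] at hp
    obtain ⟨B, ⟨hB, haB⟩, -⟩ := hp.2.2.1 a (mem_insert_self _ _)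
    have hBT : B.erase a ⊆ T := by
      rw [← subset_insert_iff]
      exact hp.2.1 B hB
    have hsd : T \ B.erase a = insert a T \ B := by
      ext b
      by_cases hba : b = a
      · subst hba
        simp [ha, haB]
      · simp [hba]
    refine ⟨⟨B.erase a, p.erase B⟩, ?_, ?_⟩
    · simp only [mem_sigma, mem_filter, mem_powerset, mem_univ, true_and, insert_erase haB, hsd]
      exact ⟨⟨hBT, hp.2.2.2 B hB⟩, hp.erase_block hB⟩
    · simp only [insert_erase haB, insert_erase hB]
  · rintro ⟨U, p⟩ hx
    simp only [mem_sigma, mem_filter, mem_powerset, mem_univ, true_and] at hx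
    have hUp : insert a U ∉ p := fun h => hnot hx.2 _ h (mem_insert_self _ _)
    simp only [card_insert_of_notMem hUp, prod_insert hUp]
    ring

open Classical in
/-- Splitting a set into three parts in two ways. -/
theorem sum_powerset_sum_powerset {α : Type*} (F : Finset α → Finset α → Finset α → ℝ)
    (T : Finset α) :
    ∑ U ∈ T.powerset, ∑ V ∈ U.powerset, F V (U \ V) (T \ U) =
      ∑ V ∈ T.powerset, ∑ W ∈ (T \ V).powerset, F V W ((T \ V) \ W) := by
  rw [sum_sigma', sum_sigma']
  refine sum_bij' (fun x _ => ⟨x.2, x.1 \ x.2⟩) (fun y _ => ⟨y.1 ∪ y.2, y.1⟩) ?_ ?_ ?_ ?_ ?_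
  · rintro ⟨U, V⟩ h
    simp only [mem_sigma, mem_powerset] at h ⊢
    exact ⟨h.2.trans h.1, sdiff_subset_sdiff h.1 subset_rfl⟩
  · rintro ⟨V, W⟩ h
    simp only [mem_sigma, mem_powerset] at h ⊢
    exact ⟨union_subset h.1 (h.2.trans sdiff_subset), subset_union_left⟩
  · rintro ⟨U, V⟩ h
    simp only [mem_sigma, mem_powerset] at h
    simp [union_sdiff_of_subset h.2]
  · rintro ⟨V, W⟩ h
    simp only [mem_sigma, mem_powerset, subset_sdiff] at h
    simp [union_sdiff_cancel_left h.2.2.symm]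
  · rintro ⟨U, V⟩ h
    simp only [mem_sigma, mem_powerset] at h
    simp only [sdiff_sdiff_left, sup_eq_union, union_sdiff_of_subset h.2]

open Classical in
theorem partSum_pow_insert (f : Finset α → ℝ) (x : ℝ) {T : Finset α} {a : α} (ha : a ∉ T) :
    partSum wt (x ^ ·) f (insert a T) = x * ∑ U ∈ T.powerset,
      (if ∑ s ∈ insert a U, wt s = 0 then f (insert a U) else 0) *
        partSum wt (x ^ ·) f (T \ U) := by
  simp only [partSum_insert wt _ f ha, pow_succ', partSum_const_mul, mul_sum]
  exact sum_congr rfl fun U _ => by ring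

open Classical in
/-- The partition polynomials are of binomial type. -/
theorem partSum_pow_add (f : Finset α → ℝ) (x y : ℝ) (S : Finset α) :
    ∑ B ∈ S.powerset, partSum wt (x ^ ·) f B * partSum wt (y ^ ·) f (S \ B) =
      partSum wt ((x + y) ^ ·) f S := by
  induction S using Finset.strongInduction with
  | H S ih =>
    rcases S.eq_empty_or_nonempty with rfl | ⟨a, haS⟩
    · simp [partSum_empty]
    · obtain ⟨T, ha, rfl⟩ : ∃ T, a ∉ T ∧ insert a T = S :=
        ⟨S.erase a, notMem_erase a S, insert_erase haS⟩
      set c : Finset α → ℝ := fun U =>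
        if ∑ s ∈ insert a U, wt s = 0 then f (insert a U) else 0 with hc
      have ih' : ∀ V ∈ T.powerset, ∑ W ∈ (T \ V).powerset,
          partSum wt (x ^ ·) f W * partSum wt (y ^ ·) f ((T \ V) \ W) =
            partSum wt ((x + y) ^ ·) f (T \ V) := fun V _ =>
        ih _ (sdiff_subset.trans_ssubset (ssubset_insert ha))
      have hx : ∑ U ∈ T.powerset,
          partSum wt (x ^ ·) f (insert a U) * partSum wt (y ^ ·) f (T \ U) =
            x * ∑ V ∈ T.powerset, c V * partSum wt ((x + y) ^ ·) f (T \ V) := by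
        rw [← sum_congr rfl fun V hV => congrArg (c V * ·) (ih' V hV)]
        simp only [mul_sum]
        rw [← sum_powerset_sum_powerset fun V W Z =>
          x * (c V * (partSum wt (x ^ ·) f W * partSum wt (y ^ ·) f Z))]
        refine sum_congr rfl fun U hU => ?_
        rw [partSum_pow_insert wt f x fun h => ha (mem_powerset.1 hU h), mul_assoc, sum_mul, mul_sum]
        exact sum_congr rfl fun V _ => by simp only [hc]; ring
      have hy : ∑ U ∈ T.powerset,
          partSum wt (x ^ ·) f U * partSum wt (y ^ ·) f (insert a (T \ U)) =
            y * ∑ V ∈ T.powerset, c V * partSum wt ((x + y) ^ ·) f (T \ V) := by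
        rw [← sum_congr rfl fun V hV => congrArg (c V * ·) (ih' V hV)]
        simp only [mul_sum]
        rw [sum_comm' (t' := T.powerset) (s' := fun W => (T \ W).powerset)]
        · refine sum_congr rfl fun U _ => ?_
          rw [partSum_pow_insert wt f y fun h => ha (mem_sdiff.1 h).1, mul_sum, mul_sum]
          refine sum_congr rfl fun V _ => ?_
          rw [sdiff_right_comm]
          simp only [hc]
          ring
        · intro V W
          simp only [mem_powerset, subset_sdiff, disjoint_comm]
          tauto
      rw [sum_powerset_insert ha, partSum_pow_insert wt f (x + y) ha, add_mul, ← hx, ← hy, add_comm]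
      refine congrArg₂ _ (sum_congr rfl fun U hU => ?_) (sum_congr rfl fun U hU => ?_)
      · rw [insert_sdiff_insert, sdiff_insert_of_notMem ha]
      · rw [insert_sdiff_of_notMem _ fun h => ha (mem_powerset.1 hU h)]

/-- Partition sums with rising factorials, of the block weights `B ↦ -partSum wt ((-1) ^ ·) f B`,
are the partition polynomials of `f`. -/
theorem partSum_risingFactorial {f h : Finset α → ℝ}
    (hh : ∀ B : Finset α, B.Nonempty → h B = -partSum wt ((-1) ^ ·) f B) (x : ℝ) (S : Finset α) :
    partSum wt (fun n => ∏ i ∈ range n, (x + i)) h S = partSum wt (x ^ ·) f S := by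
  classical
  induction S using Finset.strongInduction generalizing x with
  | H S ih =>
    rcases S.eq_empty_or_nonempty with rfl | ⟨a, haS⟩
    · simp [partSum_empty]
    · obtain ⟨T, ha, rfl⟩ : ∃ T, a ∉ T ∧ insert a T = S :=
        ⟨S.erase a, notMem_erase a S, insert_erase haS⟩
      have hg : (fun n : ℕ => ∏ i ∈ range (n + 1), (x + i)) =
          fun n : ℕ => x * ∏ i ∈ range n, (x + 1 + i) := by
        funext n
        rw [prod_range_succ', mul_comm]
        push_cast
        simp only [add_zero, add_assoc, add_comm (1 : ℝ)]
      have hh' : ∀ U : Finset α, (if ∑ s ∈ insert a U, wt s = 0 then h (insert a U) else 0) =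
          -partSum wt ((-1) ^ ·) f (insert a U) := by
        intro U
        split_ifs with h0
        · exact hh _ (insert_nonempty _ _)
        · rw [partSum_eq_zero wt _ f h0, neg_zero]
      rw [partSum_insert wt _ h ha, partSum_pow_insert wt f x ha]
      simp only [hg, partSum_const_mul, hh']
      have hx : x = -1 + (x + 1) := by ring
      have hadd : ∀ V ∈ T.powerset, partSum wt (x ^ ·) f (T \ V) =
          ∑ W ∈ (T \ V).powerset,
            partSum wt ((-1) ^ ·) f W * partSum wt ((x + 1) ^ ·) f ((T \ V) \ W) := by
        intro V _
        rw [partSum_pow_add, ← hx]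
      rw [sum_congr rfl fun V hV => congrArg (_ * ·) (hadd V hV)]
      simp only [mul_sum]
      rw [← sum_powerset_sum_powerset fun V W Z =>
        x * ((if ∑ s ∈ insert a V, wt s = 0 then f (insert a V) else 0) *
          (partSum wt ((-1) ^ ·) f W * partSum wt ((x + 1) ^ ·) f Z))]
      refine sum_congr rfl fun U hU => ?_
      rw [ih _ (sdiff_subset.trans_ssubset (ssubset_insert ha)),
        partSum_pow_insert wt f (-1) fun h => ha (mem_powerset.1 hU h), neg_one_mul, neg_neg, sum_mul]
      exact sum_congr rfl fun V _ => by ring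

theorem NPplus_eq_neg_partSum {B : Finset α} (hB : B.Nonempty) :
    NPplus wt B = -partSum wt ((-1) ^ ·) (fun C => ((C.card - 1).factorial : ℝ)) B := by
  classical
  rw [NPplus, partSum, ← sum_neg_distrib]
  refine sum_congr rfl fun q hq => ?_
  have hq0 : q.card ≠ 0 := by
    obtain ⟨b, hb⟩ := hB
    obtain ⟨C, ⟨hC, -⟩, -⟩ := (mem_filter.1 hq).2.2.2.1 b hb
    exact card_ne_zero_of_mem hC
  obtain ⟨n, hn⟩ := Nat.exists_eq_succ_of_ne_zero hq0
  simp only [hn, Xval, Nat.cast_prod, Nat.succ_eq_add_one, Nat.add_sub_cancel, pow_succ]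
  ring

end PartSum

open Classical in
theorem stmt_14 {α : Type*} [Fintype α] (wt : α → ℝ)
    (hwt : ∀ s, wt s ≠ 0) (hsum : ∑ s, wt s = 0) (hcard : 2 ≤ Fintype.card α) :
    ∀ x : ℝ,
      (∑ 𝔭 ∈ Finset.univ.filter (IsPart wt Finset.univ),
        (∏ i ∈ Finset.range 𝔭.card, (x + i)) * ∏ B ∈ 𝔭, NPplus wt B) =
      ∑ 𝔭 ∈ Finset.univ.filter (IsPart wt Finset.univ),
        x ^ 𝔭.card * (Xval 𝔭 : ℝ) := by
  intro x
  simp only [Xval, Nat.cast_prod]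
  exact partSum_risingFactorial wt (fun B hB => NPplus_eq_neg_partSum wt hB) x univ
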